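/- Let n ≥ 1 and let ω ⊂ ℝⁿ be a measurable subset satisfying liminf_{R → +∞} |ω ∩ B(0,R)| / |B(0,R)| > 0, where B(0,R) is the open Euclidean ball centered at 0 of radius R and |·| denotes Lebesgue measure. Then there exists a constant C = C(ω) > 1 such that for all N ∈ ℕ and all f ∈ E_N, one has ‖f‖_{L²(ℝⁿ)} ≤ C · e^{C N} · ‖f‖_{L²(ω)}. -/

import Mathlib

open MeasureTheory

noncomputable section

/-- The one-dimensional Hermite functions
`φ_k(x) = ((-1)^k / √(2^k k! √π)) e^{x²/2} (d/dx)^k e^{-x²}`. -/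
def hermiteFn (k : ℕ) (x : ℝ) : ℝ :=
  ((-1 : ℝ) ^ k / Real.sqrt (2 ^ k * Nat.factorial k * Real.sqrt Real.pi)) *
    Real.exp (x ^ 2 / 2) * iteratedDeriv k (fun y => Real.exp (-(y ^ 2))) x

/-- The `n`-dimensional Hermite functions `Φ_α(x) = ∏_j φ_{α_j}(x_j)`, viewed as
complex-valued functions. -/
def hermitePhi {n : ℕ} (α : Fin n → ℕ) (x : EuclideanSpace ℝ (Fin n)) : ℂ :=
  ∏ j, (hermiteFn (α j) (x j) : ℂ)

/-- `E_N`, the span of the Hermite functions `Φ_α` with `|α| ≤ N`. -/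
def hermiteSpan (n N : ℕ) : Submodule ℂ (EuclideanSpace ℝ (Fin n) → ℂ) :=
  Submodule.span ℂ {f | ∃ α : Fin n → ℕ, (∑ j, α j) ≤ N ∧ f = hermitePhi α}

end

lemma exists_sep (d : ℝ) (hd : 0 < d) (k : ℕ) : ∀ (E : Set ℝ), BddBelow E →
    ENNReal.ofReal (2 * k * d) < volume E →
    ∃ t : ℕ → ℝ, (∀ i ≤ k, t i ∈ E) ∧
      ∀ i j : ℕ, i ≤ j → j ≤ k → t i + ((j : ℝ) - i) * d ≤ t j := by
  induction k with
  | zero =>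
    intro E _ hE
    have hne : E.Nonempty := by
      by_contra h
      rw [Set.not_nonempty_iff_eq_empty] at h
      simp [h] at hE
    obtain ⟨a, ha⟩ := hne
    refine ⟨fun _ => a, fun _ _ => ha, ?_⟩
    intro i j hij hj
    obtain rfl : j = 0 := by omega
    obtain rfl : i = 0 := by omega
    simp
  | succ k ih =>
    intro E hb hE
    have hne : E.Nonempty := by
      by_contra h
      rw [Set.not_nonempty_iff_eq_empty] at h
      simp [h] at hE
    obtain ⟨a, ha, hlt⟩ := exists_lt_of_csInf_lt hne (show sInf E < sInf E + d by linarith)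
    have hsub : E ⊆ (E ∩ Set.Ici (a + d)) ∪ Set.Icc (sInf E) (sInf E + 2 * d) := by
      intro y hy
      by_cases h : a + d ≤ y
      · exact Or.inl ⟨hy, h⟩
      · exact Or.inr ⟨csInf_le hb hy, by linarith⟩
    have hvol : volume E ≤ volume (E ∩ Set.Ici (a + d)) + ENNReal.ofReal (2 * d) := by
      refine (measure_mono hsub).trans ((measure_union_le _ _).trans ?_)
      rw [Real.volume_Icc]; simp
    have h2 : ENNReal.ofReal (2 * k * d) < volume (E ∩ Set.Ici (a + d)) := by
      by_contra hcon
      push Not at hcon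
      have : volume E ≤ ENNReal.ofReal (2 * (k + 1 : ℕ) * d) := by
        refine hvol.trans ((add_le_add_left hcon _).trans ?_)
        rw [← ENNReal.ofReal_add (by positivity) (by positivity)]
        apply ENNReal.ofReal_le_ofReal
        push_cast; linarith
      exact absurd hE (not_lt.2 this)
    obtain ⟨t, ht1, ht2⟩ := ih _ (hb.mono Set.inter_subset_left) h2
    refine ⟨fun i => if i = 0 then a else t (i - 1), ?_, ?_⟩
    · intro i hi
      by_cases h : i = 0
      · simp [h, ha]
      · simp only [h, if_false]; exact (ht1 (i - 1) (by omega)).1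
    · intro i j hij hj
      rcases i with _ | i
      · rcases j with _ | j
        · simp
        · have h1 := ht2 0 j (by omega) (by omega)
          have h3 : a + d ≤ t 0 := (ht1 0 (by omega)).2
          simp at h1 ⊢
          linarith
      · rcases j with _ | j
        · omega
        · have h1 := ht2 i j (by omega) (by omega)
          simp at h1 ⊢
          linarith

lemma prod_dist (i k : ℕ) :
    ∏ j ∈ (Finset.range (i + 1 + k)).erase i, |(i : ℝ) - j| = i.factorial * k.factorial := by
  induction k with
  | zero =>
    have : (Finset.range (i + 1 + 0)).erase i = Finset.range i := by
      ext j; simp; omega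
    rw [this, ← Finset.prod_range_reflect]
    have h2 := Finset.prod_range_add_one_eq_factorial i
    simp only [Nat.factorial_zero, Nat.cast_one, mul_one]
    rw [← h2]; push_cast
    apply Finset.prod_congr rfl
    intro j hj
    have hj := Finset.mem_range.1 hj
    have : ((i - 1 - j : ℕ) : ℝ) = i - 1 - j := by
      rw [Nat.cast_sub (by omega), Nat.cast_sub (by omega)]; simp
    rw [this, abs_of_nonneg (by ring_nf; positivity)]; ring
  | succ k ih =>
    have : (Finset.range (i + 1 + (k + 1))).erase i
        = insert (i + 1 + k) ((Finset.range (i + 1 + k)).erase i) := by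
      ext j; simp; omega
    rw [this, Finset.prod_insert (by simp), ih]
    have : |(i : ℝ) - ((i + 1 + k : ℕ) : ℝ)| = k + 1 := by
      rw [abs_sub_comm, abs_of_nonneg] <;> push_cast <;> ring_nf <;> positivity
    rw [this, Nat.factorial_succ]; push_cast; ring

lemma remez1 (N : ℕ) (q : Polynomial ℂ) (hq : q.degree < (N + 1 : ℕ)) (E : Set ℝ) (L m s : ℝ)
    (hm : 0 < m) (hE : E ⊆ Set.Icc 0 L) (hL : 0 ≤ L) (hs : 0 ≤ s) (hvol : ENNReal.ofReal m ≤ volume E)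
    (hbd : ∀ t ∈ E, ‖q.eval (t : ℂ)‖ ≤ s) :
    ‖q.eval 0‖ ≤ s * ((4 * L / m) ^ N * Real.exp (N + 1)) := by
  set d : ℝ := m / (2 * (N + 1)) with hd
  have hd0 : 0 < d := by positivity
  obtain ⟨t, ht1, ht2⟩ := exists_sep d hd0 N E ⟨0, fun y hy => (hE hy).1⟩ (by
    refine lt_of_lt_of_le ?_ hvol
    rw [ENNReal.ofReal_lt_ofReal_iff hm, hd]
    rw [mul_div_assoc', div_lt_iff₀ (by positivity)]
    nlinarith)
  have hsep : ∀ i ≤ N, ∀ j ≤ N, |(i : ℝ) - j| * d ≤ |t i - t j| := by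
    intro i hi j hj
    rcases le_total i j with h | h
    · have := ht2 i j h hj
      have h' : (i : ℝ) ≤ j := by exact_mod_cast h
      rw [abs_sub_comm, abs_of_nonneg (by linarith), abs_sub_comm]
      exact le_trans (by linarith) (le_abs_self _)
    · have := ht2 j i h hi
      have h' : (j : ℝ) ≤ i := by exact_mod_cast h
      rw [abs_of_nonneg (by linarith)]
      exact le_trans (by linarith) (le_abs_self _)
  have hinj : Set.InjOn (fun i => (t i : ℂ)) (Finset.range (N + 1) : Finset ℕ) := by
    intro i hi j hj hij
    have hi : i < N + 1 := by simpa using hi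
    have hj : j < N + 1 := by simpa using hj
    have hij : t i = t j := Complex.ofReal_injective hij
    have := hsep i (by omega) j (by omega)
    rw [hij, sub_self, abs_zero] at this
    have h3 : |(i : ℝ) - j| ≤ 0 := by
      by_contra h; push Not at h; nlinarith
    have h4 : (i : ℝ) - j = 0 := abs_eq_zero.1 (le_antisymm h3 (abs_nonneg _))
    exact_mod_cast sub_eq_zero.1 h4
  have hint := Lagrange.eq_interpolate (f := q) hinj (by simpa using hq)
  have key : ∀ i ∈ Finset.range (N + 1),
      ‖(Lagrange.basis (Finset.range (N + 1)) (fun i => (t i : ℂ)) i).eval 0‖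
        ≤ (L / d) ^ N / N.factorial * (N.choose i) := by
    intro i hi
    have hi' : i ≤ N := by have := Finset.mem_range.1 hi; omega
    rw [Lagrange.basis, Polynomial.eval_prod, norm_prod]
    have : ∀ j ∈ (Finset.range (N + 1)).erase i,
        ‖(Lagrange.basisDivisor (t i : ℂ) (t j)).eval 0‖ ≤ (L / d) * |(i : ℝ) - j|⁻¹ := by
      intro j hj
      have hj' : j ≤ N := by
        have := Finset.mem_range.1 (Finset.mem_of_mem_erase hj); omega
      have hne : (i : ℝ) - j ≠ 0 := by
        rw [sub_ne_zero]; exact_mod_cast (Finset.ne_of_mem_erase hj).symm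
      have hpos : 0 < |(i : ℝ) - j| := abs_pos.2 hne
      have htj := hE (ht1 j hj')
      simp only [Lagrange.basisDivisor, Polynomial.eval_mul, Polynomial.eval_C,
        Polynomial.eval_sub, Polynomial.eval_X, zero_sub, norm_mul, norm_neg, norm_inv,
        Complex.norm_real, ← Complex.ofReal_sub, Real.norm_eq_abs]
      rw [abs_of_nonneg htj.1]
      have h1 := hsep i hi' j hj'
      calc |t i - t j|⁻¹ * t j ≤ (|(i : ℝ) - j| * d)⁻¹ * L := by
            exact mul_le_mul (inv_anti₀ (by positivity) h1) htj.2 htj.1 (by positivity)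
        _ = _ := by field_simp
    refine (Finset.prod_le_prod (fun _ _ => norm_nonneg _) this).trans ?_
    rw [Finset.prod_mul_distrib, Finset.prod_const, Finset.card_erase_of_mem hi,
      Finset.card_range, Finset.prod_inv_distrib]
    obtain ⟨k, rfl⟩ := Nat.exists_eq_add_of_le hi'
    have := prod_dist i k
    rw [show i + k + 1 = i + 1 + k by ring, this]
    have hc := Nat.choose_mul_factorial_mul_factorial (show i ≤ i + k by omega)
    rw [Nat.add_sub_cancel_left] at hc
    have hc' : ((i + k).choose i : ℝ) * i.factorial * k.factorial = (i + k).factorial := by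
      exact_mod_cast hc
    rw [← hc']
    have : 0 < ((i + k).choose i : ℝ) := by exact_mod_cast Nat.choose_pos (by omega)
    have e : i + 1 + k - 1 = i + k := by omega
    rw [e]
    apply le_of_eq
    field_simp
  have h0 : q.eval 0 = ∑ i ∈ Finset.range (N + 1), q.eval (t i : ℂ) *
      (Lagrange.basis (Finset.range (N + 1)) (fun i => (t i : ℂ)) i).eval 0 := by
    conv_lhs => rw [hint, Lagrange.interpolate_apply, Polynomial.eval_finsetSum]
    simp
  rw [h0]
  refine (norm_sum_le _ _).trans ?_
  calc _ ≤ ∑ i ∈ Finset.range (N + 1), s * ((L / d) ^ N / N.factorial * (N.choose i)) := by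
        apply Finset.sum_le_sum
        intro i hi
        rw [norm_mul]
        have hi' : i ≤ N := by have := Finset.mem_range.1 hi; omega
        exact mul_le_mul (hbd _ (ht1 i hi')) (key i hi) (norm_nonneg _) hs
    _ = s * ((L / d) ^ N / N.factorial * 2 ^ N) := by
        rw [← Finset.mul_sum, ← Finset.mul_sum]
        congr 2
        exact_mod_cast Nat.sum_range_choose N
    _ = s * ((4 * L / m) ^ N * (((N : ℝ) + 1) ^ N / N.factorial)) := by
        have : L / d = (2 * L / m) * (N + 1) := by rw [hd]; field_simp
        rw [this, mul_pow, show 4 * L / m = 2 * (2 * L / m) by ring, mul_pow 2 (2 * L / m)]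
        ring
    _ ≤ _ := by
        gcongr
        exact Real.pow_div_factorial_le_exp _ (by positivity) N

lemma polar_slice (n : ℕ) (E : Set (EuclideanSpace ℝ (Fin n)))
    (hE : MeasurableSet E) (hn : 1 ≤ n) (R : ℝ) (hER : E ⊆ Metric.ball 0 R)
    (x : EuclideanSpace ℝ (Fin n)) (m : ℝ)
    (hvol : ENNReal.ofReal m * ENNReal.ofReal ((R + ‖x‖) ^ (n - 1)) *
      (volume : Measure (EuclideanSpace ℝ (Fin n))).toSphere Set.univ < volume E) :
    ∃ θ : EuclideanSpace ℝ (Fin n), ‖θ‖ = 1 ∧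
      ENNReal.ofReal m ≤ volume {t : ℝ | 0 < t ∧ x + t • θ ∈ E} := by
  have hnt : Nontrivial (EuclideanSpace ℝ (Fin n)) := by
    have : Nonempty (Fin n) := ⟨⟨0, hn⟩⟩
    infer_instance
  by_contra hcon
  push Not at hcon
  refine absurd hvol (not_lt.2 ?_)
  set F : Set (EuclideanSpace ℝ (Fin n)) := (fun y => x + y) ⁻¹' E with hF
  have hFm : MeasurableSet F := hE.preimage (by fun_prop)
  set G : Set (Metric.sphere (0 : EuclideanSpace ℝ (Fin n)) 1 × Set.Ioi (0 : ℝ)) :=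
    {p | x + (p.2 : ℝ) • (p.1 : EuclideanSpace ℝ (Fin n)) ∈ E} with hG
  have hGm : MeasurableSet G := by
    have : Measurable fun p : Metric.sphere (0 : EuclideanSpace ℝ (Fin n)) 1 × Set.Ioi (0 : ℝ) =>
      x + (p.2 : ℝ) • (p.1 : EuclideanSpace ℝ (Fin n)) := by
      apply Continuous.measurable; fun_prop
    exact this hE
  have h1 : volume E = (volume.comap (Subtype.val : ({0}ᶜ : Set (EuclideanSpace ℝ (Fin n))) → _))
      (Subtype.val ⁻¹' F) := by
    rw [comap_subtype_coe_apply (measurableSet_singleton _).compl, Subtype.image_preimage_coe,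
      Set.inter_comm, ← Set.sdiff_eq, measure_sdiff_null (measure_singleton _), hF,
      measure_preimage_add]
  have h2 : (Subtype.val ⁻¹' F : Set ({0}ᶜ : Set (EuclideanSpace ℝ (Fin n)))) =
      homeomorphUnitSphereProd (EuclideanSpace ℝ (Fin n)) ⁻¹' G := by
    ext y
    simp only [hF, hG, Set.mem_preimage, Set.mem_ofPred_eq, homeomorphUnitSphereProd_apply_fst_coe,
      homeomorphUnitSphereProd_apply_snd_coe]
    rw [smul_smul, mul_inv_cancel₀ (norm_ne_zero_iff.2 y.2), one_smul]
  rw [h1, h2, (Measure.measurePreserving_homeomorphUnitSphereProd volume).measure_preimage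
    hGm.nullMeasurableSet, Measure.prod_apply hGm]
  rw [← lintegral_const]
  apply lintegral_mono
  intro θ
  have hθ : ‖(θ : EuclideanSpace ℝ (Fin n))‖ = 1 := by simp
  have hS : MeasurableSet (Prod.mk θ ⁻¹' G) := measurable_prodMk_left hGm
  simp only [finrank_euclideanSpace, Fintype.card_fin]
  rw [Measure.volumeIoiPow, withDensity_apply _ hS]
  calc _ ≤ ∫⁻ _ in (Prod.mk θ ⁻¹' G), ENNReal.ofReal ((R + ‖x‖) ^ (n - 1))
          ∂(Measure.comap Subtype.val volume) := by
        apply setLIntegral_mono measurable_const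
        intro t ht
        have ht0 : (0 : ℝ) < t := t.2
        have h3 := hER ht
        rw [mem_ball_zero_iff] at h3
        have h4 : (t : ℝ) ≤ R + ‖x‖ := by
          have : ‖(t : ℝ) • (θ : EuclideanSpace ℝ (Fin n))‖ = t := by
            rw [norm_smul, hθ, mul_one, Real.norm_of_nonneg ht0.le]
          have h5 := norm_sub_le (x + (t : ℝ) • (θ : EuclideanSpace ℝ (Fin n))) x
          rw [add_sub_cancel_left, this] at h5
          linarith
        gcongr
    _ = ENNReal.ofReal ((R + ‖x‖) ^ (n - 1)) *
          volume {t : ℝ | 0 < t ∧ x + t • (θ : EuclideanSpace ℝ (Fin n)) ∈ E} := by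
        rw [setLIntegral_const, comap_subtype_coe_apply measurableSet_Ioi]
        congr 2
        ext t
        simp [hG, and_comm]
    _ ≤ _ := by
        rw [mul_comm]
        gcongr
        exact (hcon θ hθ).le

def GoodPoly (n N : ℕ) (g : EuclideanSpace ℝ (Fin n) → ℂ) : Prop :=
  Continuous g ∧ ∀ x θ : EuclideanSpace ℝ (Fin n), ∃ q : Polynomial ℂ, q.natDegree ≤ N ∧
    ∀ t : ℝ, g (x + t • θ) = q.eval (t : ℂ)

lemma iteratedDeriv_gauss (k : ℕ) : ∃ q : Polynomial ℝ, q.natDegree ≤ k ∧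
    iteratedDeriv k (fun y : ℝ => Real.exp (-(y ^ 2))) =
      fun y => q.eval y * Real.exp (-(y ^ 2)) := by
  induction k with
  | zero => exact ⟨1, by simp, by simp⟩
  | succ k ih =>
    obtain ⟨q, hq, h⟩ := ih
    refine ⟨Polynomial.derivative q - Polynomial.C 2 * Polynomial.X * q, ?_, ?_⟩
    · refine (Polynomial.natDegree_sub_le _ _).trans (max_le ?_ ?_)
      · exact (Polynomial.natDegree_derivative_le q).trans (by omega)
      · refine Polynomial.natDegree_mul_le.trans ?_
        have : (Polynomial.C (2 : ℝ) * Polynomial.X).natDegree ≤ 1 := 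
          (Polynomial.natDegree_C_mul_le _ _).trans Polynomial.natDegree_X_le
        omega
    · rw [iteratedDeriv_succ, h]
      funext y
      have h1 : HasDerivAt (fun y : ℝ => Real.exp (-(y ^ 2)))
          (Real.exp (-(y ^ 2)) * (-(2 * y))) y := by
        have := ((hasDerivAt_pow 2 y).neg).exp
        simpa using this
      have := ((q.hasDerivAt y).mul h1).deriv
      have e : (fun y : ℝ => q.eval y * Real.exp (-(y ^ 2))) =
        (fun y => q.eval y) * (fun y : ℝ => Real.exp (-(y ^ 2))) := rfl
      rw [e, this]
      simp
      ring

lemma hermiteFn_form (k : ℕ) : ∃ q : Polynomial ℝ, q.natDegree ≤ k ∧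
    ∀ y, hermiteFn k y = q.eval y * Real.exp (-(y ^ 2) / 2) := by
  obtain ⟨q, hq, h⟩ := iteratedDeriv_gauss k
  refine ⟨Polynomial.C ((-1 : ℝ) ^ k /
    Real.sqrt (2 ^ k * Nat.factorial k * Real.sqrt Real.pi)) * q,
    (Polynomial.natDegree_C_mul_le _ _).trans hq, ?_⟩
  intro y
  rw [hermiteFn, h]
  have : Real.exp (-(y ^ 2) / 2) = Real.exp (y ^ 2 / 2) * Real.exp (-(y ^ 2)) := by
    rw [← Real.exp_add]; ring_nf
  rw [this]
  simp only [Polynomial.eval_mul, Polynomial.eval_C]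
  ring

lemma hermitePhi_form {n N : ℕ} (α : Fin n → ℕ) (hα : ∑ j, α j ≤ N) :
    ∃ g, GoodPoly n N g ∧ ∀ x, hermitePhi α x = g x * (Real.exp (-‖x‖ ^ 2 / 2) : ℂ) := by
  choose q hq h using hermiteFn_form
  refine ⟨fun x => ∏ j, (((q (α j)).eval (x j) : ℝ) : ℂ), ⟨?_, ?_⟩, ?_⟩
  · refine continuous_finsetProd _ fun j _ => ?_
    have : Continuous fun x : EuclideanSpace ℝ (Fin n) => x j := by fun_prop
    exact Complex.continuous_ofReal.comp ((q (α j)).continuous.comp this)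
  · intro x θ
    refine ⟨∏ j, ((q (α j)).map Complex.ofRealHom).comp
      (Polynomial.C (θ j : ℂ) * Polynomial.X + Polynomial.C (x j : ℂ)), ?_, ?_⟩
    · refine (Polynomial.natDegree_prod_le _ _).trans (le_trans ?_ hα)
      apply Finset.sum_le_sum
      intro j _
      refine Polynomial.natDegree_comp_le.trans ?_
      calc _ ≤ α j * 1 := by
            refine Nat.mul_le_mul ?_ Polynomial.natDegree_linear_le
            exact Polynomial.natDegree_map_le.trans (hq _)
        _ = α j := mul_one _
    · intro t
      rw [Polynomial.eval_prod]
      refine Finset.prod_congr rfl fun j _ => ?_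
      rw [Polynomial.eval_comp]
      have : Polynomial.eval (t : ℂ) (Polynomial.C (θ j : ℂ) * Polynomial.X + Polynomial.C (x j : ℂ))
        = Complex.ofRealHom ((x + t • θ) j) := by
        simp; ring
      rw [this, Polynomial.eval_map, Polynomial.eval₂_hom]
      rfl
  · intro x
    rw [hermitePhi]
    simp only [h, Complex.ofReal_mul, Finset.prod_mul_distrib]
    congr 1
    rw [← Complex.ofReal_prod, ← Real.exp_sum, EuclideanSpace.norm_sq_eq]
    congr 2
    rw [← Finset.sum_div, ← Finset.sum_neg_distrib]
    simp

lemma hermiteSpan_form {n N : ℕ} (f : EuclideanSpace ℝ (Fin n) → ℂ) (hf : f ∈ hermiteSpan n N) :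
    ∃ g, GoodPoly n N g ∧ ∀ x, f x = g x * (Real.exp (-‖x‖ ^ 2 / 2) : ℂ) := by
  induction hf using Submodule.span_induction with
  | mem f hf =>
    obtain ⟨α, hα, rfl⟩ := hf
    exact hermitePhi_form α hα
  | zero => exact ⟨0, ⟨continuous_zero, fun _ _ => ⟨0, by simp, by simp⟩⟩, by simp⟩
  | add f₁ f₂ _ _ h₁ h₂ =>
    obtain ⟨g₁, ⟨c₁, p₁⟩, e₁⟩ := h₁
    obtain ⟨g₂, ⟨c₂, p₂⟩, e₂⟩ := h₂
    refine ⟨g₁ + g₂, ⟨c₁.add c₂, fun x θ => ?_⟩, fun x => ?_⟩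
    · obtain ⟨q₁, d₁, r₁⟩ := p₁ x θ
      obtain ⟨q₂, d₂, r₂⟩ := p₂ x θ
      exact ⟨q₁ + q₂, (Polynomial.natDegree_add_le _ _).trans (max_le d₁ d₂),
        fun t => by simp [r₁, r₂]⟩
    · simp only [Pi.add_apply, e₁, e₂]; ring
  | smul a f _ h =>
    obtain ⟨g, ⟨c, p⟩, e⟩ := h
    refine ⟨a • g, ⟨c.const_smul a, fun x θ => ?_⟩, fun x => ?_⟩
    · obtain ⟨q, d, r⟩ := p x θ
      exact ⟨a • q, (Polynomial.natDegree_smul_le _ _).trans d, fun t => by simp [r]⟩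
    · simp only [Pi.smul_apply, e, smul_eq_mul]; ring

lemma pointwise_sup {n N : ℕ} (hn : 1 ≤ n) (g : EuclideanSpace ℝ (Fin n) → ℂ)
    (hg : GoodPoly n N g) (E : Set (EuclideanSpace ℝ (Fin n))) (hE : MeasurableSet E) (R : ℝ)
    (hR : 0 < R) (hER : E ⊆ Metric.ball 0 R) (κ : ℝ) (hκ : 0 < κ)
    (hvol : ENNReal.ofReal (κ * R ^ n / 2) ≤ volume E) (s : ℝ) (hs : 0 ≤ s)
    (hbd : ∀ y ∈ E, ‖g y‖ ≤ s) (x : EuclideanSpace ℝ (Fin n)) :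
    ‖g x‖ ≤ s * ((16 * ((volume : Measure (EuclideanSpace ℝ (Fin n))).toSphere.real Set.univ + 1) / κ)
      ^ N * Real.exp (n * N * ‖x‖ / R) * Real.exp (N + 1)) := by
  set σ : ℝ := (volume : Measure (EuclideanSpace ℝ (Fin n))).toSphere.real Set.univ with hσ
  have hσ0 : 0 ≤ σ := measureReal_nonneg
  set L : ℝ := R + ‖x‖ with hL
  have hL0 : 0 < L := by positivity
  set m : ℝ := κ * R ^ n / (4 * (σ + 1) * L ^ (n - 1)) with hm
  have hm0 : 0 < m := by positivity
  obtain ⟨θ, hθ, hvθ⟩ := polar_slice n E hE hn R hER x m (by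
    refine lt_of_lt_of_le ?_ hvol
    have : (volume : Measure (EuclideanSpace ℝ (Fin n))).toSphere Set.univ = ENNReal.ofReal σ := by
      rw [hσ, ofReal_measureReal]
    rw [this, ← ENNReal.ofReal_mul hm0.le, ← ENNReal.ofReal_mul (by positivity),
      ENNReal.ofReal_lt_ofReal_iff (by positivity)]
    have e : m * L ^ (n - 1) * σ = κ * R ^ n * (σ / (4 * (σ + 1))) := by
      rw [hm]; field_simp
    rw [← hL, e, div_eq_mul_inv]
    have h2 : σ / (4 * (σ + 1)) < 2⁻¹ := by
      rw [div_lt_iff₀ (by positivity)]; linarith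
    have : 0 < κ * R ^ n := by positivity
    exact mul_lt_mul_of_pos_left h2 this)
  obtain ⟨q, hq, hqe⟩ := hg.2 x θ
  have h1 := remez1 N q (by
      refine lt_of_le_of_lt Polynomial.degree_le_natDegree ?_
      exact_mod_cast Nat.lt_succ_of_le hq) {t : ℝ | 0 < t ∧ x + t • θ ∈ E} L m s hm0 (by
      rintro t ⟨ht0, ht⟩
      refine ⟨ht0.le, ?_⟩
      have h3 := hER ht
      rw [mem_ball_zero_iff] at h3
      have : ‖t • θ‖ = t := by
        rw [norm_smul, hθ, mul_one, Real.norm_of_nonneg ht0.le]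
      have h5 := norm_sub_le (x + t • θ) x
      rw [add_sub_cancel_left, this] at h5
      linarith) hL0.le hs hvθ (by
      rintro t ⟨_, ht⟩
      rw [← hqe]; exact hbd _ ht)
  have h0 : g x = q.eval 0 := by
    have := hqe 0
    simpa using this
  rw [h0]
  refine h1.trans ?_
  have e1 : 4 * L / m = 16 * (σ + 1) / κ * (1 + ‖x‖ / R) ^ n := by
    have : (1 + ‖x‖ / R) = L / R := by rw [hL]; field_simp
    have e2 : L ^ n = L ^ (n - 1) * L := by rw [← pow_succ]; congr 1; omega
    rw [this, hm, div_pow, e2]; field_simp; ring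
  have e3 : ((1 + ‖x‖ / R) ^ n) ^ N ≤ Real.exp (n * N * ‖x‖ / R) := by
    have h6 : 1 + ‖x‖ / R ≤ Real.exp (‖x‖ / R) := by
      rw [add_comm]; exact Real.add_one_le_exp _
    calc _ ≤ ((Real.exp (‖x‖ / R)) ^ n) ^ N := by gcongr
      _ = _ := by rw [← Real.exp_nat_mul, ← Real.exp_nat_mul]; congr 1; ring
  rw [e1, mul_pow]
  gcongr

lemma pointwise_L2 {n N : ℕ} (hn : 1 ≤ n) (g : EuclideanSpace ℝ (Fin n) → ℂ)
    (hg : GoodPoly n N g) (E : Set (EuclideanSpace ℝ (Fin n))) (hE : MeasurableSet E) (R : ℝ)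
    (hR : 0 < R) (hER : E ⊆ Metric.ball 0 R) (κ : ℝ) (hκ : 0 < κ)
    (hvol : κ * R ^ n ≤ volume.real E) (hint : IntegrableOn (fun y => ‖g y‖ ^ 2) E)
    (x : EuclideanSpace ℝ (Fin n)) :
    ‖g x‖ ^ 2 ≤ (2 / (κ * R ^ n) * ∫ y in E, ‖g y‖ ^ 2) *
      ((16 * ((volume : Measure (EuclideanSpace ℝ (Fin n))).toSphere.real Set.univ + 1) / κ)
      ^ N * Real.exp (n * N * ‖x‖ / R) * Real.exp (N + 1)) ^ 2 := by
  set σ : ℝ := (volume : Measure (EuclideanSpace ℝ (Fin n))).toSphere.real Set.univ with hσ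
  have hσ0 : 0 ≤ σ := measureReal_nonneg
  set Q : ℝ := ((16 * (σ + 1) / κ) ^ N * Real.exp (n * N * ‖x‖ / R) * Real.exp (N + 1)) with hQ
  have hQ0 : 0 < Q := by positivity
  set A : ℝ := ∫ y in E, ‖g y‖ ^ 2 with hA
  have hA0 : 0 ≤ A := integral_nonneg fun y => by positivity
  set b : ℝ := κ * R ^ n with hb
  have hb0 : 0 < b := by positivity
  have hEfin : volume E ≠ ⊤ :=
    ((measure_mono hER).trans_lt measure_ball_lt_top).ne
  have key : ∀ T : ℝ, 2 / b * A < T → ‖g x‖ ^ 2 ≤ T * Q ^ 2 := by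
    intro T hT
    have hT0 : 0 < T := lt_of_le_of_lt (by positivity) hT
    have hmar := mul_meas_ge_le_integral_of_nonneg (μ := volume.restrict E)
      (f := fun y => ‖g y‖ ^ 2) (Filter.Eventually.of_forall fun y => by positivity) hint T
    have hms : MeasurableSet {y | T ≤ ‖g y‖ ^ 2} :=
      measurableSet_le measurable_const (hg.1.norm.pow 2).measurable
    rw [measureReal_restrict_apply hms] at hmar
    have hm2 : volume.real ({y | T ≤ ‖g y‖ ^ 2} ∩ E) ≤ b / 2 := by
      by_contra hc
      push Not at hc
      have : A < T * (b / 2) := by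
        rw [div_mul_eq_mul_div, div_lt_iff₀ hb0] at hT; linarith
      have := mul_lt_mul_of_pos_left hc hT0
      linarith
    have hE' : volume.real (E \ {y | T ≤ ‖g y‖ ^ 2}) ≥ b / 2 := by
      have h := measureReal_inter_add_sdiff (μ := volume) (s := E) hms (h := hEfin)
      rw [Set.inter_comm] at h
      linarith
    have := pointwise_sup hn g hg (E \ {y | T ≤ ‖g y‖ ^ 2}) (hE.diff hms) R hR
      (Set.sdiff_subset.trans hER) κ hκ (by
        rw [← ofReal_measureReal (measure_ne_top_of_subset Set.sdiff_subset hEfin)]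
        exact ENNReal.ofReal_le_ofReal hE') (Real.sqrt T) (Real.sqrt_nonneg _) (by
        rintro y ⟨_, hy⟩
        apply Real.le_sqrt_of_sq_le
        have : ¬ T ≤ ‖g y‖ ^ 2 := hy
        linarith) x
    rw [← hσ, ← hQ] at this
    calc ‖g x‖ ^ 2 ≤ (Real.sqrt T * Q) ^ 2 := by gcongr
      _ = T * Q ^ 2 := by rw [mul_pow, Real.sq_sqrt hT0.le]
  rw [← div_le_iff₀ (by positivity)]
  apply le_of_forall_gt_imp_ge_of_dense
  intro T hT
  rw [div_le_iff₀ (by positivity)]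
  exact key T hT

lemma integrable_gauss (n : ℕ) :
    Integrable (fun x : EuclideanSpace ℝ (Fin n) => Real.exp (-(1 / 2) * ‖x‖ ^ 2)) := by
  have h := GaussianFourier.integral_rexp_neg_mul_sq_norm (V := EuclideanSpace ℝ (Fin n))
    (b := 1 / 2) (by norm_num)
  by_contra hc
  rw [integral_undef hc] at h
  have : 0 < (Real.pi / (1 / 2)) ^ ((Module.finrank ℝ (EuclideanSpace ℝ (Fin n)) : ℝ) / 2) := by
    positivity
  linarith

lemma density {n : ℕ} (ω : Set (EuclideanSpace ℝ (Fin n)))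
    (hliminf : 0 < Filter.liminf
      (fun R : ℝ => volume (ω ∩ Metric.ball (0 : EuclideanSpace ℝ (Fin n)) R) /
        volume (Metric.ball (0 : EuclideanSpace ℝ (Fin n)) R)) Filter.atTop) :
    ∃ κ > 0, ∃ R₀ : ℝ, 1 ≤ R₀ ∧ ∀ R ≥ R₀,
      κ * R ^ n ≤ volume.real (ω ∩ Metric.ball (0 : EuclideanSpace ℝ (Fin n)) R) := by
  obtain ⟨δ, hδ0, hδ⟩ := exists_between hliminf
  have hδt : δ ≠ ⊤ := (hδ.trans_le le_top).ne
  have hev := Filter.eventually_lt_of_lt_liminf hδ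
  obtain ⟨R₁, hR₁⟩ := Filter.eventually_atTop.1 hev
  have hb1 : 0 < volume.real (Metric.ball (0 : EuclideanSpace ℝ (Fin n)) 1) :=
    ENNReal.toReal_pos (Metric.measure_ball_pos volume 0 one_pos).ne' measure_ball_lt_top.ne
  refine ⟨δ.toReal * volume.real (Metric.ball (0 : EuclideanSpace ℝ (Fin n)) 1),
    mul_pos (ENNReal.toReal_pos hδ0.ne' hδt) hb1, max 1 R₁, le_max_left _ _, ?_⟩
  intro R hR
  have hR1 : 1 ≤ R := (le_max_left _ _).trans hR
  have h1 := hR₁ R ((le_max_right _ _).trans hR)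
  have h2 := ENNReal.mul_lt_of_lt_div h1
  have h3 := ENNReal.toReal_mono
    (measure_ne_top_of_subset Set.inter_subset_right measure_ball_lt_top.ne) h2.le
  rw [ENNReal.toReal_mul, Measure.addHaar_ball_of_pos volume 0 (by linarith : (0 : ℝ) < R),
    ENNReal.toReal_mul, ENNReal.toReal_ofReal (by positivity)] at h3
  simp only [finrank_euclideanSpace, Fintype.card_fin] at h3
  calc _ = _ := by rw [measureReal_def]; ring
    _ ≤ _ := h3

/-- **Spectral inequality for measurable control subsets of positive lower density at
infinity.** If `ω ⊂ ℝⁿ` (`n ≥ 1`) is measurable and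
`liminf_{R → ∞} |ω ∩ B(0,R)| / |B(0,R)| > 0`, then there exists `C = C(ω) > 1` such that
for all `N ∈ ℕ` and all `f ∈ E_N`, `‖f‖_{L²(ℝⁿ)} ≤ C e^{C N} ‖f‖_{L²(ω)}`. -/
theorem spectral_inequality_liminf (n : ℕ) (hn : 1 ≤ n)
    (ω : Set (EuclideanSpace ℝ (Fin n))) (hω : MeasurableSet ω)
    (hliminf : 0 < Filter.liminf
      (fun R : ℝ => volume (ω ∩ Metric.ball (0 : EuclideanSpace ℝ (Fin n)) R) /
        volume (Metric.ball (0 : EuclideanSpace ℝ (Fin n)) R)) Filter.atTop) :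
    ∃ C : ℝ, 1 < C ∧ ∀ N : ℕ, ∀ f ∈ hermiteSpan n N,
      Real.sqrt (∫ x, ‖f x‖ ^ 2) ≤
        C * Real.exp (C * N) * Real.sqrt (∫ x in ω, ‖f x‖ ^ 2) := by
  obtain ⟨κ, hκ, R₀, hR₀, hdens⟩ := density ω hliminf
  set σ : ℝ := (volume : Measure (EuclideanSpace ℝ (Fin n))).toSphere.real Set.univ with hσ
  have hσ0 : 0 ≤ σ := measureReal_nonneg
  set K : ℝ := 16 * (σ + 1) / κ with hK
  have hK0 : 0 < K := by positivity
  set I : ℝ := ∫ x : EuclideanSpace ℝ (Fin n), Real.exp (-(1 / 2) * ‖x‖ ^ 2) with hI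
  have hI0 : 0 ≤ I := integral_nonneg fun x => by positivity
  set D : ℝ := 2 / κ * Real.exp 2 * I * Real.exp (R₀ ^ 2) with hD
  have hD0 : 0 ≤ D := by positivity
  set D' : ℝ := 2 * Real.log K + 2 + 2 * n ^ 2 + 1 with hD'
  have main : ∀ N : ℕ, ∀ f ∈ hermiteSpan n N,
      ∫ x, ‖f x‖ ^ 2 ≤ D * Real.exp (D' * N) * ∫ x in ω, ‖f x‖ ^ 2 := by
    intro N f hf
    obtain ⟨g, hg, hfg⟩ := hermiteSpan_form f hf
    set R : ℝ := Real.sqrt (R₀ ^ 2 + N) with hR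
    have hR2 : R ^ 2 = R₀ ^ 2 + N := Real.sq_sqrt (by positivity)
    have hRR : R₀ ≤ R := Real.le_sqrt_of_sq_le (by
      have : (0 : ℝ) ≤ N := Nat.cast_nonneg N
      linarith)
    have hR1 : 1 ≤ R := hR₀.trans hRR
    have hR0 : 0 < R := by linarith
    set E := ω ∩ Metric.ball (0 : EuclideanSpace ℝ (Fin n)) R with hE
    have hEm : MeasurableSet E := hω.inter measurableSet_ball
    have hgint : IntegrableOn (fun y => ‖g y‖ ^ 2) E := by
      have h1 : IntegrableOn (fun y => ‖g y‖ ^ 2) (Metric.closedBall 0 R) :=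
        (hg.1.norm.pow 2).continuousOn.integrableOn_compact (isCompact_closedBall _ _)
      exact h1.mono_set (Set.inter_subset_right.trans Metric.ball_subset_closedBall)
    have hpt := pointwise_L2 hn g hg E hEm R hR0 Set.inter_subset_right κ hκ (hdens R hRR) hgint
    rw [← hσ, ← hK] at hpt
    set A : ℝ := ∫ y in E, ‖g y‖ ^ 2 with hA
    have hA0 : 0 ≤ A := integral_nonneg fun y => by positivity
    have hnorm : ∀ x, ‖f x‖ ^ 2 = ‖g x‖ ^ 2 * Real.exp (-‖x‖ ^ 2) := by
      intro x
      rw [hfg, norm_mul, mul_pow, Complex.norm_real, Real.norm_of_nonneg (Real.exp_pos _).le,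
        ← Real.exp_nat_mul]
      congr 2
      push_cast; ring
    have hfc : Continuous fun x => ‖f x‖ ^ 2 := by
      have : (fun x => ‖f x‖ ^ 2) = fun x => ‖g x‖ ^ 2 * Real.exp (-‖x‖ ^ 2) := funext hnorm
      rw [this]
      have := hg.1
      fun_prop
    set M : ℝ := 2 / κ * A * (K ^ N * Real.exp (N + 1)) ^ 2 * Real.exp (2 * n ^ 2 * N) with hM
    have hbound : ∀ x, ‖f x‖ ^ 2 ≤ M * Real.exp (-(1 / 2) * ‖x‖ ^ 2) := by
      intro x
      have hexp : Real.exp (n * N * ‖x‖ / R) ^ 2 * Real.exp (-‖x‖ ^ 2) ≤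
          Real.exp (2 * n ^ 2 * N) * Real.exp (-(1 / 2) * ‖x‖ ^ 2) := by
        rw [← Real.exp_nat_mul, ← Real.exp_add, ← Real.exp_add]
        apply Real.exp_le_exp.2
        set u : ℝ := N / R with hu
        have hu2 : u ^ 2 ≤ N := by
          rw [hu, div_pow, div_le_iff₀ (by positivity), hR2]
          have : (0 : ℝ) ≤ N := Nat.cast_nonneg N
          nlinarith [sq_nonneg R₀]
        have e : (n : ℝ) * N * ‖x‖ / R = n * u * ‖x‖ := by rw [hu]; ring
        rw [e]
        have h3 : (n : ℝ) ^ 2 * u ^ 2 ≤ n ^ 2 * N := by gcongr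
        push_cast
        nlinarith [sq_nonneg (2 * (n * u) - ‖x‖)]
      have hκR : 2 / (κ * R ^ n) ≤ 2 / κ := by
        have : 1 ≤ R ^ n := one_le_pow₀ hR1
        gcongr
        nlinarith
      rw [hnorm]
      calc ‖g x‖ ^ 2 * Real.exp (-‖x‖ ^ 2)
          ≤ ((2 / (κ * R ^ n) * A) * (K ^ N * Real.exp (n * N * ‖x‖ / R) * Real.exp (N + 1)) ^ 2)
            * Real.exp (-‖x‖ ^ 2) := by gcongr; exact hpt x
        _ ≤ ((2 / κ * A) * (K ^ N * Real.exp (n * N * ‖x‖ / R) * Real.exp (N + 1)) ^ 2)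
            * Real.exp (-‖x‖ ^ 2) := by gcongr
        _ = (2 / κ * A) * (K ^ N * Real.exp (N + 1)) ^ 2 *
            (Real.exp (n * N * ‖x‖ / R) ^ 2 * Real.exp (-‖x‖ ^ 2)) := by ring
        _ ≤ (2 / κ * A) * (K ^ N * Real.exp (N + 1)) ^ 2 *
            (Real.exp (2 * n ^ 2 * N) * Real.exp (-(1 / 2) * ‖x‖ ^ 2)) := by gcongr
        _ = _ := by rw [hM]; ring
    have hgi : Integrable (fun x : EuclideanSpace ℝ (Fin n) =>
        M * Real.exp (-(1 / 2) * ‖x‖ ^ 2)) := (integrable_gauss n).const_mul M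
    have hfi : Integrable (fun x => ‖f x‖ ^ 2) :=
      hgi.mono' hfc.aestronglyMeasurable (Filter.Eventually.of_forall fun x => by
        rw [Real.norm_of_nonneg (by positivity)]; exact hbound x)
    have h1 : ∫ x, ‖f x‖ ^ 2 ≤ M * I := by
      rw [hI, ← integral_const_mul]
      exact integral_mono hfi hgi hbound
    have h2 : A ≤ Real.exp (R ^ 2) * ∫ x in ω, ‖f x‖ ^ 2 := by
      calc A ≤ ∫ x in E, Real.exp (R ^ 2) * ‖f x‖ ^ 2 := by
            refine setIntegral_mono_on hgint (hfi.integrableOn.const_mul _) hEm ?_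
            intro x hx
            have hx2 : ‖x‖ < R := mem_ball_zero_iff.1 hx.2
            rw [hnorm, mul_left_comm, ← Real.exp_add]
            have : 1 ≤ Real.exp (R ^ 2 + -‖x‖ ^ 2) := by
              apply Real.one_le_exp
              nlinarith [norm_nonneg x]
            nlinarith [sq_nonneg ‖g x‖]
        _ = Real.exp (R ^ 2) * ∫ x in E, ‖f x‖ ^ 2 := integral_const_mul _ _
        _ ≤ _ := by
            refine mul_le_mul_of_nonneg_left ?_ (Real.exp_pos _).le
            exact setIntegral_mono_set hfi.integrableOn
              (Filter.Eventually.of_forall fun x => by positivity)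
              (Filter.Eventually.of_forall fun x hx => Set.inter_subset_left hx)
    have hKN : K ^ N = Real.exp (N * Real.log K) := by
      rw [Real.exp_nat_mul, Real.exp_log hK0]
    calc ∫ x, ‖f x‖ ^ 2 ≤ M * I := h1
      _ ≤ (2 / κ * (Real.exp (R ^ 2) * ∫ x in ω, ‖f x‖ ^ 2) * (K ^ N * Real.exp (N + 1)) ^ 2 *
          Real.exp (2 * n ^ 2 * N)) * I := by rw [hM]; gcongr
      _ = (2 / κ * I * ∫ x in ω, ‖f x‖ ^ 2) * (Real.exp (R ^ 2) * (K ^ N * Real.exp (N + 1)) ^ 2 *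
          Real.exp (2 * n ^ 2 * N)) := by ring
      _ = (2 / κ * I * ∫ x in ω, ‖f x‖ ^ 2) *
          (Real.exp 2 * Real.exp (R₀ ^ 2) * Real.exp (D' * N)) := by
          congr 1
          rw [hKN, hR2, ← Real.exp_add, ← Real.exp_nat_mul, ← Real.exp_add, ← Real.exp_add,
            ← Real.exp_add, ← Real.exp_add, hD']
          congr 1
          push_cast; ring
      _ = _ := by rw [hD]; ring
  refine ⟨2 + D + |D'|, by have := abs_nonneg D'; linarith, ?_⟩
  intro N f hf
  set C : ℝ := 2 + D + |D'| with hC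
  have hD'0 := abs_nonneg D'
  have hC0 : 0 ≤ C := by positivity
  have hY : 0 ≤ ∫ x in ω, ‖f x‖ ^ 2 := integral_nonneg fun x => by positivity
  have hle : D * Real.exp (D' * N) ≤ (C * Real.exp (C * N)) ^ 2 := by
    rw [mul_pow, ← Real.exp_nat_mul]
    have hN : (0 : ℝ) ≤ N := Nat.cast_nonneg N
    have a1 : D ≤ C ^ 2 := by nlinarith
    have a2 : Real.exp (D' * N) ≤ Real.exp ((2 : ℕ) * (C * N)) := by
      apply Real.exp_le_exp.2
      have : D' ≤ 2 * C := by linarith [le_abs_self D']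
      push_cast
      nlinarith
    gcongr
  calc Real.sqrt (∫ x, ‖f x‖ ^ 2)
      ≤ Real.sqrt ((C * Real.exp (C * N)) ^ 2 * ∫ x in ω, ‖f x‖ ^ 2) := by
        apply Real.sqrt_le_sqrt
        exact (main N f hf).trans (mul_le_mul_of_nonneg_right hle hY)
    _ = _ := by
        rw [Real.sqrt_mul (by positivity), Real.sqrt_sq (by positivity)]
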